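/- Let χ be a countable set of cadlag F^o-adapted real processes which are uniformly bounded on each interval [0,T], and assume the martingale problem associated to χ is well-posed, with solutions (ℙ^{s,η}). Then for every s ∈ ℝ₊: (i) the map Φ_s : η ↦ ℙ^{s,η}, from Ω^s := {η ∈ Ω : η = η^s} (equipped with the trace of F^o_s) to the space of probability measures on (Ω,F) (equipped with the σ-field generated by the evaluation maps ℙ ↦ ℙ(F)), is measurable; (ii) the map η ↦ ℙ^{s,η} from Ω to the space of probability measures is F^o_s-measurable, i.e. (s,η) ↦ ℙ^{s,η} is F^o-adapted. -/

import Mathlib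

open MeasureTheory Filter Topology Set
open scoped NNReal ENNReal

noncomputable section

/-- A function indexed by `ℝ≥0` is *cadlag* if it is right-continuous and has
left limits at every positive time. -/
def IsCadlag {X : Type*} [TopologicalSpace X] (f : ℝ≥0 → X) : Prop :=
  (∀ t : ℝ≥0, Tendsto f (𝓝[Set.Ici t] t) (𝓝 (f t))) ∧
    ∀ t : ℝ≥0, 0 < t → ∃ l : X, Tendsto f (𝓝[Set.Iio t] t) (𝓝 l)

variable (E : Type*) [MetricSpace E] [MeasurableSpace E]

/-- The canonical path space `Ω = D(ℝ₊, E)` of cadlag paths with values in `E`. -/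
def PathOmega := {f : ℝ≥0 → E // IsCadlag f}

/-- The canonical σ-field `𝓕 = σ(X_r ; r ≥ 0)` on the path space. -/
instance instPathOmegaMS : MeasurableSpace (PathOmega E) :=
  ⨆ r : ℝ≥0, MeasurableSpace.comap (fun ω : PathOmega E => ω.1 r) inferInstance

/-- The initial filtration `𝓕^o_t = σ(X_r ; r ≤ t)`. -/
def Fot (t : ℝ≥0) : MeasurableSpace (PathOmega E) :=
  ⨆ r ∈ Set.Iic t, MeasurableSpace.comap (fun ω : PathOmega E => ω.1 r) inferInstance

/-- The canonical (right-continuous) filtration `𝓕_t = ⋂_{s > t} 𝓕^o_s`. -/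
def Ft (t : ℝ≥0) : MeasurableSpace (PathOmega E) :=
  ⨅ u ∈ Set.Ioi t, Fot E u

variable {E}

/-- A *path-dependent canonical class*. -/
structure IsPathCanonicalClass (P : ℝ≥0 → PathOmega E → Measure (PathOmega E)) : Prop where
  isProb : ∀ s η, IsProbabilityMeasure (P s η)
  starts : ∀ (s : ℝ≥0) (η : PathOmega E), P s η {ω | ∀ r ≤ s, ω.1 r = η.1 r} = 1
  fos_meas : ∀ (s : ℝ≥0) (F : Set (PathOmega E)), MeasurableSet F →
    Measurable[Fot E s] fun η => P s η F
  cond : ∀ (s : ℝ≥0) (η : PathOmega E) (t : ℝ≥0), s ≤ t →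
    ∀ F : Set (PathOmega E), MeasurableSet F →
      ∀ G : Set (PathOmega E), MeasurableSet[Fot E t] G →
        ∫⁻ ω in G, P t ω F ∂(P s η) = P s η (F ∩ G)

variable (E)


/-- A process `M` is a martingale on `[s, ∞)` with respect to the measure `μ`
and the filtration `𝔽`: it is integrable at each time `t ≥ s` and has the
martingale property for `s ≤ t ≤ u`, expressed through set integrals over
`𝔽 t`-measurable events. -/
def IsMartingaleOn (μ : Measure (PathOmega E))
    (𝔽 : ℝ≥0 → MeasurableSpace (PathOmega E))
    (M : ℝ≥0 → PathOmega E → ℝ) (s : ℝ≥0) : Prop :=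
  (∀ t : ℝ≥0, s ≤ t → Integrable (M t) μ) ∧
    ∀ t u : ℝ≥0, s ≤ t → t ≤ u → ∀ G : Set (PathOmega E), MeasurableSet[𝔽 t] G →
      ∫ ω in G, M u ω ∂μ = ∫ ω in G, M t ω ∂μ


/-- A probability measure `μ` solves the martingale problem with respect to a
set of processes `χ` starting in `(s,η)`: `μ(ω^s = η^s) = 1` and every element
of `χ` is a `(μ, 𝓕^o)`-martingale on `[s, ∞)`. -/
def SolvesMP (χ : Set (ℝ≥0 → PathOmega E → ℝ)) (s : ℝ≥0) (η : PathOmega E)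
    (μ : Measure (PathOmega E)) : Prop :=
  μ {ω | ∀ r ≤ s, ω.1 r = η.1 r} = 1 ∧
    ∀ M ∈ χ, IsMartingaleOn E μ (Fot E) M s

section StandardBorel

open ProbabilityTheory

variable {α β : Type*} [MeasurableSpace α] [MeasurableSpace β]

theorem MeasurableEmbedding.standardBorelSpace [StandardBorelSpace β] {f : α → β}
    (hf : MeasurableEmbedding f) : StandardBorelSpace α := by
  have : StandardBorelSpace (range f) := hf.measurableSet_range.standardBorel
  obtain ⟨_, _, _⟩ := StandardBorelSpace.polish (α := range f)
  let e : α ≃ᵐ range f := hf.equivRange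
  let _ : TopologicalSpace α := TopologicalSpace.induced e inferInstance
  have : BorelSpace α := ⟨by
    rw [borel_comap, ← BorelSpace.measurable_eq (α := range f), e.measurableEmbedding.comap_eq]⟩
  have : PolishSpace α := e.toEquiv.polishSpace_induced
  infer_instance

theorem measurable_probabilityMeasure_toReal_apply {s : Set α} (hs : MeasurableSet s) :
    Measurable fun μ : ProbabilityMeasure α => ((μ : Measure α) s).toReal :=
  ((Measure.measurable_coe hs).comp measurable_subtype_coe).ennreal_toReal

/-- The restriction to `ℚ` of the distribution function of a probability measure on `ℝ`. -/
def ratCDF (μ : ProbabilityMeasure ℝ) (q : ℚ) : ℝ := ((μ : Measure ℝ) (Iic (q : ℝ))).toReal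

theorem ratCDF_eq_cdf (μ : ProbabilityMeasure ℝ) (q : ℚ) : ratCDF μ q = cdf (μ : Measure ℝ) q := by
  rw [cdf_eq_real]; rfl

theorem isRatStieltjesPoint_ratCDF (μ : ProbabilityMeasure ℝ) :
    IsRatStieltjesPoint (id : (ℚ → ℝ) → ℚ → ℝ) (ratCDF μ) where
  mono p q h := by
    simp only [id, ratCDF_eq_cdf]
    exact monotone_cdf _ (by exact_mod_cast h)
  tendsto_atTop_one := by
    have := (tendsto_cdf_atTop (μ : Measure ℝ)).comp (tendsto_ratCast_atTop_iff.2 tendsto_id)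
    exact this.congr fun q => (ratCDF_eq_cdf μ q).symm
  tendsto_atBot_zero := by
    have := (tendsto_cdf_atBot (μ : Measure ℝ)).comp (tendsto_ratCast_atBot_iff.2 tendsto_id)
    exact this.congr fun q => (ratCDF_eq_cdf μ q).symm
  iInf_rat_gt_eq t := by
    simp only [id, ratCDF_eq_cdf]
    rw [← StieltjesFunction.iInf_rat_gt_eq]
    exact (Equiv.subtypeEquivRight fun q => by simp).iInf_congr fun q => rfl

/-- The probability measure on `ℝ` whose distribution function extends a given function on `ℚ`. -/
def probabilityMeasureOfRatCDF (a : ℚ → ℝ) : ProbabilityMeasure ℝ :=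
  ⟨(stieltjesOfMeasurableRat id measurable_id a).measure, inferInstance⟩

theorem ratCDF_probabilityMeasureOfRatCDF {a : ℚ → ℝ}
    (ha : IsRatStieltjesPoint (id : (ℚ → ℝ) → ℚ → ℝ) a) :
    ratCDF (probabilityMeasureOfRatCDF a) = a := by
  funext q
  rw [ratCDF, probabilityMeasureOfRatCDF, ProbabilityMeasure.coe_mk,
    measure_stieltjesOfMeasurableRat_Iic,
    ENNReal.toReal_ofReal (stieltjesOfMeasurableRat_nonneg _ _ _), stieltjesOfMeasurableRat_eq,
    toRatCDF_of_isRatStieltjesPoint ha, id]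

theorem ratCDF_injective : Function.Injective ratCDF := by
  intro μ ν h
  have := μ.2
  have := ν.2
  refine Subtype.ext (Measure.eq_of_cdf μ.1 ν.1 ?_)
  ext x
  rw [← StieltjesFunction.iInf_rat_gt_eq, ← StieltjesFunction.iInf_rat_gt_eq]
  refine iInf_congr fun q => ?_
  have hq := congrFun h q
  rwa [ratCDF_eq_cdf, ratCDF_eq_cdf] at hq

theorem measurableEmbedding_ratCDF : MeasurableEmbedding ratCDF := by
  have hrange : range ratCDF = {a | IsRatStieltjesPoint (id : (ℚ → ℝ) → ℚ → ℝ) a} := by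
    ext a
    refine ⟨?_, fun ha => ⟨_, ratCDF_probabilityMeasureOfRatCDF ha⟩⟩
    rintro ⟨μ, rfl⟩
    exact isRatStieltjesPoint_ratCDF μ
  refine MeasurableEmbedding.of_measurable_inverse (g := probabilityMeasureOfRatCDF) ?_ ?_ ?_ ?_
  · exact measurable_pi_lambda _ fun q =>
      measurable_probabilityMeasure_toReal_apply measurableSet_Iic
  · rw [hrange]
    exact measurableSet_isRatStieltjesPoint measurable_id
  · exact (measurable_measure_stieltjesOfMeasurableRat measurable_id).subtype_mk
  · intro μ
    exact ratCDF_injective (ratCDF_probabilityMeasureOfRatCDF (isRatStieltjesPoint_ratCDF μ))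

/-- The push-forward of probability measures along a measurable embedding is a measurable
embedding. -/
theorem MeasurableEmbedding.probabilityMeasure_map {f : α → β} (hf : MeasurableEmbedding f) :
    MeasurableEmbedding fun μ : ProbabilityMeasure α => μ.map hf.measurable.aemeasurable := by
  have hmap : Measurable fun μ : ProbabilityMeasure α => μ.map hf.measurable.aemeasurable :=
    ((Measure.measurable_map f hf.measurable).comp measurable_subtype_coe).subtype_mk
  have hprob : ∀ ν : {ν : ProbabilityMeasure β | (ν : Measure β) (range f) = 1},
      IsProbabilityMeasure ((ν : Measure β).comap f) := fun ν =>
    ⟨by rw [hf.comap_apply, image_univ]; exact ν.2⟩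
  have hrange : range (fun μ : ProbabilityMeasure α => μ.map hf.measurable.aemeasurable) =
      {ν : ProbabilityMeasure β | (ν : Measure β) (range f) = 1} := by
    ext ν
    constructor
    · rintro ⟨μ, rfl⟩
      simp [ProbabilityMeasure.toMeasure_map, hf.map_apply]
    · intro hν
      have hν' : ∀ᵐ b ∂(ν : Measure β), b ∈ range f :=
        (prob_compl_eq_zero_iff hf.measurableSet_range).2 hν
      refine ⟨⟨(ν : Measure β).comap f, hprob ⟨ν, hν⟩⟩, Subtype.ext ?_⟩
      change ((ν : Measure β).comap f).map f = ν
      rw [hf.map_comap, Measure.restrict_eq_self_of_ae_mem hν']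
  refine MeasurableEmbedding.of_measurable_inverse_on_range hmap ?_
    (g := fun ν => ⟨(ν : Measure β).comap f, hprob ⟨ν.1, hrange ▸ ν.2⟩⟩) ?_ ?_
  · rw [hrange]
    exact (Measure.measurable_coe hf.measurableSet_range).comp measurable_subtype_coe
      (measurableSet_singleton 1)
  · refine Measurable.subtype_mk (Measure.measurable_of_measurable_coe _ fun s hs => ?_)
    simp_rw [hf.comap_apply]
    exact (Measure.measurable_coe (hf.measurableSet_image.2 hs)).comp
      (measurable_subtype_coe.comp measurable_subtype_coe)
  · intro μ
    exact Subtype.ext (hf.comap_map μ)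

instance ProbabilityMeasure.instStandardBorelSpace [StandardBorelSpace α] :
    StandardBorelSpace (ProbabilityMeasure α) :=
  haveI := measurableEmbedding_ratCDF.standardBorelSpace
  (measurableEmbedding_embeddingReal α).probabilityMeasure_map.standardBorelSpace

end StandardBorel

section CadlagPaths

variable {X : Type*} [MetricSpace X]

/-- A countable dense set of times. -/
abbrev DenseTime : Type := range (TopologicalSpace.denseSeq ℝ≥0)

instance DenseTime.instCountable : Countable DenseTime := (countable_range _).to_subtype

theorem dense_denseTime : Dense (range (TopologicalSpace.denseSeq ℝ≥0)) :=
  TopologicalSpace.denseRange_denseSeq ℝ≥0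

theorem exists_seq_denseTime_tendsto (t : ℝ≥0) :
    ∃ k : ℕ → DenseTime, (∀ n, t < k n) ∧ Tendsto (fun n => (k n : ℝ≥0)) atTop (𝓝 t) := by
  obtain ⟨k, -, hk, hlim⟩ := dense_denseTime.exists_seq_strictAnti_tendsto t
  exact ⟨fun n => ⟨k n, (hk n).2⟩, fun n => (hk n).1, hlim⟩

theorem neBot_comap_denseTime {S : Set ℝ≥0} (hS : IsOpen S) {t : ℝ≥0} [(𝓝[S] t).NeBot] :
    (comap ((↑) : DenseTime → ℝ≥0) (𝓝[S] t)).NeBot := by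
  refine comap_neBot_iff.2 fun A hA => ?_
  obtain ⟨U, hU, htU, hUA⟩ := mem_nhdsWithin.1 hA
  obtain ⟨x, hx⟩ := (inferInstance : (𝓝[S] t).NeBot).nonempty_of_mem
    (inter_mem (mem_nhdsWithin_of_mem_nhds (hU.mem_nhds htU)) self_mem_nhdsWithin)
  obtain ⟨y, hy, hyD⟩ := dense_denseTime.inter_open_nonempty _ (hU.inter hS) ⟨x, hx⟩
  exact ⟨⟨y, hyD⟩, hUA hy⟩

/-- The Skorokhod-type oscillation condition: on bounded time intervals, among any three nearby
times the middle value is close to one of the two others. -/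
def HasSmallOscillation (f : DenseTime → X) : Prop :=
  ∀ T e : ℕ, ∃ d : ℕ, ∀ p q r : DenseTime, p < q → q < r → (r : ℝ≥0) ≤ T →
    dist (r : ℝ≥0) p < 1 / (d + 1) →
      dist (f q) (f p) ≤ 1 / (e + 1) ∨ dist (f r) (f q) ≤ 1 / (e + 1)

theorem exists_tendsto_of_eventually_dist_le [CompleteSpace X] {ι : Type*} {l : Filter ι} [l.NeBot]
    {f : ι → X} (h : ∀ e : ℕ, ∃ c, ∀ᶠ i in l, dist (f i) c ≤ 1 / (e + 1)) :
    ∃ x, Tendsto f l (𝓝 x) := by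
  refine cauchy_map_iff_exists_tendsto.1 (Metric.cauchy_iff.2 ⟨inferInstance, fun ε hε => ?_⟩)
  obtain ⟨e, he⟩ := exists_nat_one_div_lt (half_pos hε)
  obtain ⟨c, hc⟩ := h e
  refine ⟨f '' {i | dist (f i) c ≤ 1 / (e + 1)}, image_mem_map hc, ?_⟩
  rintro _ ⟨i, hi, rfl⟩ _ ⟨j, hj, rfl⟩
  have := dist_triangle_right (f i) (f j) c
  simp only [mem_ofPred_eq] at hi hj
  linarith

theorem HasSmallOscillation.exists_tendsto [CompleteSpace X] {f : DenseTime → X}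
    (hf : HasSmallOscillation f) {t : ℝ≥0} {S : Set ℝ≥0} (hS : S = Ioi t ∨ S = Iio t)
    [(𝓝[S] t).NeBot] :
    ∃ x, Tendsto f (comap (↑) (𝓝[S] t)) (𝓝 x) := by
  have hSo : IsOpen S := by rcases hS with rfl | rfl <;> simp [isOpen_Ioi, isOpen_Iio]
  have := neBot_comap_denseTime hSo (t := t)
  refine exists_tendsto_of_eventually_dist_le fun e => ?_
  obtain ⟨T, hT⟩ := exists_nat_gt t
  obtain ⟨d, hd⟩ := hf T e
  have hδ : (0 : ℝ) < 1 / (d + 1) / 2 := by positivity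
  have hI : {x : ℝ≥0 | x < T ∧ dist x t < 1 / (d + 1) / 2} ∩ S ∈ 𝓝[S] t :=
    inter_mem (mem_nhdsWithin_of_mem_nhds
      (inter_mem (Iio_mem_nhds hT) (Metric.ball_mem_nhds t hδ))) self_mem_nhdsWithin
  have hI' := preimage_mem_comap (m := ((↑) : DenseTime → ℝ≥0)) hI
  have key : ∀ p q r : DenseTime, p < q → q < r →
      (p : ℝ≥0) ∈ {x : ℝ≥0 | x < T ∧ dist x t < 1 / (d + 1) / 2} ∩ S →
      (r : ℝ≥0) ∈ {x : ℝ≥0 | x < T ∧ dist x t < 1 / (d + 1) / 2} ∩ S →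
      dist (f q) (f p) ≤ 1 / (e + 1) ∨ dist (f r) (f q) ≤ 1 / (e + 1) := by
    intro p q r hpq hqr hp hr
    refine hd p q r hpq hqr hr.1.1.le ?_
    have h1 := hp.1.2
    have h2 := hr.1.2
    have := dist_triangle_right (r : ℝ≥0) p t
    linarith
  by_cases hbad : ∃ p q : DenseTime, p < q ∧
      (p : ℝ≥0) ∈ {x : ℝ≥0 | x < T ∧ dist x t < 1 / (d + 1) / 2} ∩ S ∧
      (q : ℝ≥0) ∈ {x : ℝ≥0 | x < T ∧ dist x t < 1 / (d + 1) / 2} ∩ S ∧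
      1 / (e + 1) < dist (f q) (f p)
  · obtain ⟨p, q, hpq, hp, hq, hfar⟩ := hbad
    rcases hS with rfl | rfl
    · refine ⟨f p, ?_⟩
      have hlt : {x : ℝ≥0 | x < p} ∈ 𝓝[>] t :=
        mem_nhdsWithin_of_mem_nhds (Iio_mem_nhds hp.2)
      filter_upwards [hI', preimage_mem_comap (m := ((↑) : DenseTime → ℝ≥0)) hlt] with x hx hxp
      rw [dist_comm]
      exact (key x p q hxp hpq hx hq).resolve_right hfar.not_ge
    · refine ⟨f q, ?_⟩
      have hlt : {x : ℝ≥0 | q < x} ∈ 𝓝[<] t :=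
        mem_nhdsWithin_of_mem_nhds (Ioi_mem_nhds hq.2)
      filter_upwards [hI', preimage_mem_comap (m := ((↑) : DenseTime → ℝ≥0)) hlt] with x hx hqx
      exact (key p q x hpq hqx hp hx).resolve_left hfar.not_ge
  · push Not at hbad
    obtain ⟨q, hq⟩ := Filter.nonempty_of_mem hI'
    refine ⟨f q, ?_⟩
    filter_upwards [hI'] with x hx
    rcases lt_trichotomy x q with h | rfl | h
    · rw [dist_comm]
      exact hbad x q h hx hq
    · rw [dist_self]
      positivity
    · exact hbad q x h hq hx

/-- Limits of the right limits of `f` along an open set of times are limits of `f`. -/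
theorem tendsto_nhdsWithin_of_tendsto_comap {f : DenseTime → X} {g : ℝ≥0 → X}
    (hg : ∀ t, Tendsto f (comap (↑) (𝓝[>] t)) (𝓝 (g t))) {S : Set ℝ≥0} (hS : IsOpen S) {t : ℝ≥0}
    {x : X} (hx : Tendsto f (comap (↑) (𝓝[S] t)) (𝓝 x)) :
    Tendsto g (𝓝[S] t) (𝓝 x) := by
  refine (closed_nhds_basis x).tendsto_right_iff.2 fun V hV => ?_
  have h := eventually_comap.1 (hx hV.1)
  filter_upwards [eventually_eventually_nhdsWithin.2 h, self_mem_nhdsWithin] with y hy hyS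
  rw [hS.nhdsWithin_eq hyS] at hy
  have := neBot_comap_denseTime (isOpen_Ioi (a := y)) (t := y)
  refine hV.2.mem_of_tendsto (hg y) (eventually_comap.2 ?_)
  exact hy.filter_mono nhdsWithin_le_nhds

theorem exists_isCadlag_extension [CompleteSpace X] {f : DenseTime → X}
    (hosc : HasSmallOscillation f)
    (hright : ∀ n : DenseTime, Tendsto f (comap (↑) (𝓝[≥] (n : ℝ≥0))) (𝓝 (f n))) :
    ∃ g : ℝ≥0 → X, IsCadlag g ∧ ∀ n : DenseTime, g n = f n := by
  choose g hg using fun t => hosc.exists_tendsto (S := Ioi t) (Or.inl rfl)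
  refine ⟨g, ⟨fun t => ?_, fun t ht => ?_⟩, fun n => ?_⟩
  · exact continuousWithinAt_Ioi_iff_Ici.1 (tendsto_nhdsWithin_of_tendsto_comap hg isOpen_Ioi (hg t))
  · have : (𝓝[<] t).NeBot := nhdsLT_neBot_of_exists_lt ⟨0, ht⟩
    obtain ⟨l, hl⟩ := hosc.exists_tendsto (S := Iio t) (Or.inr rfl)
    exact ⟨l, tendsto_nhdsWithin_of_tendsto_comap hg isOpen_Iio hl⟩
  · have := neBot_comap_denseTime (isOpen_Ioi (a := (n : ℝ≥0))) (t := n)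
    exact tendsto_nhds_unique (hg n)
      ((hright n).mono_left (comap_mono (nhdsWithin_mono _ Ioi_subset_Ici_self)))

theorem IsCadlag.exists_isOpen_oscillation_le {g : ℝ≥0 → X} (hg : IsCadlag g) {ε : ℝ}
    (hε : 0 < ε) (t : ℝ≥0) :
    ∃ V : Set ℝ≥0, IsOpen V ∧ t ∈ V ∧ ∀ p ∈ V, ∀ q ∈ V, ∀ r ∈ V, p < q → q < r →
      dist (g q) (g p) ≤ ε ∨ dist (g r) (g q) ≤ ε := by
  have hr : ∀ᶠ x in 𝓝 t, x ∈ Ici t → dist (g x) (g t) < ε / 2 :=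
    eventually_nhdsWithin_iff.1 (Metric.tendsto_nhds.1 (hg.1 t) _ (half_pos hε))
  have hl : ∃ c, ∀ᶠ x in 𝓝 t, x ∈ Iio t → dist (g x) c < ε / 2 := by
    rcases eq_or_ne t 0 with rfl | ht
    · exact ⟨g 0, Eventually.of_forall fun x hx => absurd (mem_Iio.1 hx) not_lt_zero⟩
    · obtain ⟨c, hc⟩ := hg.2 t (pos_iff_ne_zero.2 ht)
      exact ⟨c, eventually_nhdsWithin_iff.1 (Metric.tendsto_nhds.1 hc _ (half_pos hε))⟩
  obtain ⟨c, hc⟩ := hl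
  obtain ⟨V, hV, hVo, htV⟩ := eventually_nhds_iff.1 (hr.and hc)
  refine ⟨V, hVo, htV, fun p hp q hq r hr hpq hqr => ?_⟩
  rcases lt_or_ge q t with hqt | hqt
  · left
    have h1 := (hV q hq).2 hqt
    have h2 := (hV p hp).2 (hpq.trans hqt)
    have := dist_triangle_right (g q) (g p) c
    linarith
  · right
    have h1 := (hV q hq).1 hqt
    have h2 := (hV r hr).1 (hqt.trans hqr.le)
    have := dist_triangle_right (g r) (g q) (g t)
    linarith

theorem IsCadlag.hasSmallOscillation {g : ℝ≥0 → X} (hg : IsCadlag g) :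
    HasSmallOscillation fun n : DenseTime => g n := by
  intro T e
  choose V hVo hmem hV using
    hg.exists_isOpen_oscillation_le (ε := 1 / ((e : ℝ) + 1)) (by positivity)
  obtain ⟨δ, hδ, hball⟩ := lebesgue_number_lemma_of_metric (isCompact_Icc (a := (0 : ℝ≥0)) (b := T))
    hVo fun t _ => mem_iUnion.2 ⟨t, hmem t⟩
  obtain ⟨d, hd⟩ := exists_nat_one_div_lt hδ
  refine ⟨d, fun p q r hpq hqr hrT hrp => ?_⟩
  obtain ⟨t, ht⟩ := hball p ⟨zero_le, (Subtype.coe_le_coe.2 (hpq.trans hqr).le).trans hrT⟩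
  have hrδ : dist (r : ℝ≥0) p < δ := hrp.trans hd
  have hqp : dist (q : ℝ≥0) p ≤ dist (r : ℝ≥0) p := by
    have h1 : ((p : ℝ≥0) : ℝ) < (q : ℝ≥0) := hpq
    have h2 : ((q : ℝ≥0) : ℝ) < (r : ℝ≥0) := hqr
    rw [NNReal.dist_eq, NNReal.dist_eq, abs_of_pos (by linarith), abs_of_pos (by linarith)]
    linarith
  exact hV t p (ht (Metric.mem_ball_self hδ)) q (ht (hqp.trans_lt hrδ)) r (ht hrδ) hpq hqr

theorem IsCadlag.tendsto_comap {g : ℝ≥0 → X} (hg : IsCadlag g) (n : DenseTime) :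
    Tendsto (fun m : DenseTime => g m) (comap (↑) (𝓝[≥] (n : ℝ≥0))) (𝓝 (g n)) :=
  (hg.1 n).comp Filter.tendsto_comap

theorem IsCadlag.tendsto_seq {Y : Type*} [TopologicalSpace Y] {g : ℝ≥0 → Y} (hg : IsCadlag g)
    {t : ℝ≥0} {k : ℕ → ℝ≥0} (hk : ∀ n, t ≤ k n) (hlim : Tendsto k atTop (𝓝 t)) :
    Tendsto (fun n => g (k n)) atTop (𝓝 (g t)) :=
  (hg.1 t).comp (tendsto_nhdsWithin_iff.2 ⟨hlim, Eventually.of_forall hk⟩)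

theorem measurableSet_hasSmallOscillation [MeasurableSpace X] [BorelSpace X]
    [SecondCountableTopology X] :
    MeasurableSet {f : DenseTime → X | HasSmallOscillation f} := by
  refine measurableSet_setOfPred.2 ?_
  unfold HasSmallOscillation
  have hle : ∀ (p q : DenseTime) (c : ℝ),
      Measurable fun f : DenseTime → X => dist (f p) (f q) ≤ c := fun p q c =>
    measurableSet_setOfPred.1 (measurableSet_le (by fun_prop) measurable_const)
  refine Measurable.forall fun T => Measurable.forall fun e => Measurable.exists fun d =>
    Measurable.forall fun p => Measurable.forall fun q => Measurable.forall fun r => ?_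
  exact measurable_const.imp <| measurable_const.imp <| measurable_const.imp <|
    measurable_const.imp <| (hle q p _).or (hle r q _)

end CadlagPaths

section PathSampling

variable {E : Type*} [MetricSpace E]

/-- The path `ω` stopped at time `s`, sampled along the countable dense set of times. -/
def stoppedSample (s : ℝ≥0) (ω : PathOmega E) (n : DenseTime) : E := ω.1 (min n s)

/-- The path `ω` sampled along the countable dense set of times. -/
def pathSample (ω : PathOmega E) (n : DenseTime) : E := ω.1 n

/-- A right-limit argument: evaluations of paths along a monotone continuous time change are
limits of those at the dense times. -/
theorem tendsto_eval_comp (ω : PathOmega E) {φ : ℝ≥0 → ℝ≥0} (hφ : Monotone φ) (hφc : Continuous φ)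
    {r : ℝ≥0} {k : ℕ → ℝ≥0} (hk : ∀ n, r < k n) (hlim : Tendsto k atTop (𝓝 r)) :
    Tendsto (fun n => ω.1 (φ (k n))) atTop (𝓝 (ω.1 (φ r))) :=
  ω.2.tendsto_seq (fun n => hφ (hk n).le) ((hφc.tendsto r).comp hlim)

theorem eval_comp_congr {ω η : PathOmega E} {φ : ℝ≥0 → ℝ≥0} (hφ : Monotone φ) (hφc : Continuous φ)
    (h : ∀ n : DenseTime, ω.1 (φ n) = η.1 (φ n)) (r : ℝ≥0) : ω.1 (φ r) = η.1 (φ r) := by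
  obtain ⟨k, hk, hlim⟩ := exists_seq_denseTime_tendsto r
  refine tendsto_nhds_unique (tendsto_eval_comp ω hφ hφc hk hlim) ?_
  simp_rw [h]
  exact tendsto_eval_comp η hφ hφc hk hlim

theorem monotone_min_right (s : ℝ≥0) : Monotone fun r : ℝ≥0 => min r s :=
  fun _ _ h => min_le_min_right s h

theorem stoppedSample_eq_iff {s : ℝ≥0} {ω η : PathOmega E} :
    stoppedSample s ω = stoppedSample s η ↔ ∀ r ≤ s, ω.1 r = η.1 r := by
  refine ⟨fun h r hr => ?_, fun h => funext fun n => h _ (min_le_right _ _)⟩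
  have := eval_comp_congr (monotone_min_right s) (continuous_id.min continuous_const)
    (congrFun h) r
  simpa only [min_eq_left hr] using this

theorem range_pathSample [CompleteSpace E] :
    range (pathSample (E := E)) = {f | HasSmallOscillation f} ∩
      {f | ∀ n : DenseTime, Tendsto f (comap (↑) (𝓝[≥] (n : ℝ≥0))) (𝓝 (f n))} := by
  ext f
  constructor
  · rintro ⟨ω, rfl⟩
    exact ⟨ω.2.hasSmallOscillation, fun n => ω.2.tendsto_comap n⟩
  · rintro ⟨hosc, hright⟩
    obtain ⟨g, hg, hgf⟩ := exists_isCadlag_extension hosc hright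
    exact ⟨⟨g, hg⟩, funext hgf⟩

end PathSampling

section PathSpace

variable {E : Type*} [MetricSpace E] [MeasurableSpace E]

theorem measurable_eval (r : ℝ≥0) : Measurable fun ω : PathOmega E => ω.1 r :=
  measurable_iff_comap_le.2
    (le_iSup (fun r => MeasurableSpace.comap (fun ω : PathOmega E => ω.1 r) inferInstance) r)

theorem measurable_Fot_eval {r s : ℝ≥0} (h : r ≤ s) :
    Measurable[Fot E s] fun ω : PathOmega E => ω.1 r :=
  measurable_iff_comap_le.2 (le_iSup₂ (f := fun r (_ : r ∈ Iic s) =>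
    MeasurableSpace.comap (fun ω : PathOmega E => ω.1 r) inferInstance) r h)

theorem Fot_le (s : ℝ≥0) : Fot E s ≤ instPathOmegaMS E :=
  iSup₂_le fun r _ => measurable_iff_comap_le.1 (measurable_eval r)

theorem Fot_mono {s t : ℝ≥0} (h : s ≤ t) : Fot E s ≤ Fot E t :=
  iSup₂_le fun _ hr => measurable_iff_comap_le.1 (measurable_Fot_eval (le_trans hr h))

theorem measurable_eval_comp [BorelSpace E] {m : MeasurableSpace (PathOmega E)} {φ : ℝ≥0 → ℝ≥0}
    (hφ : Monotone φ) (hφc : Continuous φ)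
    (h : ∀ n : DenseTime, Measurable[m] fun ω : PathOmega E => ω.1 (φ n)) (r : ℝ≥0) :
    Measurable[m] fun ω : PathOmega E => ω.1 (φ r) := by
  obtain ⟨k, hk, hlim⟩ := exists_seq_denseTime_tendsto r
  exact measurable_of_tendsto_metrizable (fun n => h (k n))
    (tendsto_pi_nhds.2 fun ω => tendsto_eval_comp ω hφ hφc hk hlim)

theorem Fot_eq_comap [BorelSpace E] (s : ℝ≥0) :
    Fot E s = MeasurableSpace.comap (stoppedSample s) inferInstance := by
  refine le_antisymm (iSup₂_le fun r hr => measurable_iff_comap_le.1 ?_)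
    (measurable_iff_comap_le.1
      (@measurable_pi_lambda _ _ _ (Fot E s) _ _ fun n => measurable_Fot_eval (min_le_right _ _)))
  have := measurable_eval_comp (m := MeasurableSpace.comap (stoppedSample s) inferInstance)
    (monotone_min_right s) (continuous_id.min continuous_const)
    (fun n => (measurable_pi_apply n).comp (comap_measurable (stoppedSample (E := E) s))) r
  simpa only [min_eq_left (mem_Iic.1 hr)] using this

theorem measurable_stoppedSample (s : ℝ≥0) : Measurable (stoppedSample (E := E) s) :=
  measurable_pi_lambda _ fun _ => measurable_eval _

theorem measurableEmbedding_pathSample [CompleteSpace E] [SecondCountableTopology E]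
    [BorelSpace E] : MeasurableEmbedding (pathSample (E := E)) := by
  refine MeasurableEmbedding.iff_comap_eq.2 ⟨fun ω η h => Subtype.ext (funext
    (eval_comp_congr monotone_id continuous_id (congrFun h))), le_antisymm ?_ ?_, ?_⟩
  · exact measurable_iff_comap_le.1 (measurable_pi_lambda _ fun n => measurable_eval _)
  · refine iSup_le fun r => measurable_iff_comap_le.1 ?_
    exact measurable_eval_comp (m := MeasurableSpace.comap pathSample inferInstance)
      monotone_id continuous_id
      (fun n => (measurable_pi_apply n).comp (comap_measurable (pathSample (E := E)))) r
  · rw [range_pathSample, ofPred_forall]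
    exact measurableSet_hasSmallOscillation.inter (MeasurableSet.iInter fun n =>
      measurableSet_tendsto_fun (fun m => measurable_pi_apply m) (measurable_pi_apply n))

instance PathOmega.instStandardBorelSpace [CompleteSpace E] [SecondCountableTopology E]
    [BorelSpace E] : StandardBorelSpace (PathOmega E) :=
  measurableEmbedding_pathSample.standardBorelSpace

end PathSpace

section MartingaleProblem

open ProbabilityTheory

theorem exists_countable_isPiSystem_generateFrom (α : Type*) [m : MeasurableSpace α]
    [MeasurableSpace.CountablyGenerated α] :
    ∃ C : Set (Set α), C.Countable ∧ IsPiSystem C ∧ univ ∈ C ∧ m = MeasurableSpace.generateFrom C :=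
  ⟨generateSetAlgebra (MeasurableSpace.countableGeneratingSet α),
    countable_generateSetAlgebra MeasurableSpace.countable_countableGeneratingSet,
    fun _ hs _ ht _ => isSetAlgebra_generateSetAlgebra.inter_mem hs ht,
    isSetAlgebra_generateSetAlgebra.univ_mem,
    by rw [generateFrom_generateSetAlgebra_eq, MeasurableSpace.generateFrom_countableGeneratingSet]⟩

theorem setIntegral_eq_of_isPiSystem {α β : Type*} {mα : MeasurableSpace α} {mβ : MeasurableSpace β}
    {μ : Measure α} {f g : α → ℝ} (hf : Integrable f μ) (hg : Integrable g μ) {j : α → β}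
    (hj : Measurable j) {C : Set (Set β)} (hC : mβ = MeasurableSpace.generateFrom C)
    (hpi : IsPiSystem C) (huniv : univ ∈ C)
    (h : ∀ B ∈ C, ∫ ω in j ⁻¹' B, f ω ∂μ = ∫ ω in j ⁻¹' B, g ω ∂μ) {B : Set β}
    (hB : MeasurableSet B) : ∫ ω in j ⁻¹' B, f ω ∂μ = ∫ ω in j ⁻¹' B, g ω ∂μ := by
  induction B, hB using MeasurableSpace.induction_on_inter hC hpi with
  | empty => simp
  | basic B hB => exact h B hB
  | compl B hB ih =>
    have htot := h univ huniv
    simp only [preimage_univ, setIntegral_univ] at htot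
    rw [preimage_compl, setIntegral_compl (hj hB) hf, setIntegral_compl (hj hB) hg, htot, ih]
  | iUnion B hd hB ih =>
    have hd' : Pairwise (Function.onFun Disjoint fun i => j ⁻¹' B i) :=
      fun i k hik => (hd hik).preimage j
    rw [preimage_iUnion, integral_iUnion (fun i => hj (hB i)) hd' hf.integrableOn,
      integral_iUnion (fun i => hj (hB i)) hd' hg.integrableOn]
    exact tsum_congr ih

theorem measurable_setIntegral_probabilityMeasure {α : Type*} [MeasurableSpace α] {f : α → ℝ}
    (hf : Measurable f) {s : Set α} (hs : MeasurableSet s) :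
    Measurable fun μ : ProbabilityMeasure α => ∫ ω in s, f ω ∂(μ : Measure α) := by
  let κ : Kernel (ProbabilityMeasure α) α := ⟨(↑), measurable_subtype_coe⟩
  have : Measurable fun μ => ∫ ω, s.indicator f ω ∂(κ μ) :=
    (hf.indicator hs).stronglyMeasurable.integral_kernel.measurable
  simp_rw [integral_indicator hs] at this
  exact this

theorem measurableSet_setOf_apply_fiber_eq_one {α β : Type*} [MeasurableSpace α]
    [MeasurableSpace β] [MeasurableEq β] {j : α → β} (hj : Measurable j) :
    MeasurableSet {p : β × ProbabilityMeasure α | (p.2 : Measure α) {ω | j ω = p.1} = 1} := by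
  let κ : Kernel (β × ProbabilityMeasure α) α :=
    ⟨fun p => (p.2 : Measure α), measurable_subtype_coe.comp measurable_snd⟩
  have : IsMarkovKernel κ := ⟨fun p => p.2.2⟩
  have ht : MeasurableSet {q : (β × ProbabilityMeasure α) × α | j q.2 = q.1.1} :=
    measurableSet_eq_fun (hj.comp measurable_snd) (measurable_fst.comp measurable_fst)
  exact Kernel.measurable_kernel_prodMk_left (κ := κ) ht (measurableSet_singleton 1)

variable {E : Type*} [MetricSpace E] [MeasurableSpace E]

theorem tendsto_setIntegral_of_isCadlag {μ : Measure (PathOmega E)} [IsFiniteMeasure μ]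
    {M : ℝ≥0 → PathOmega E → ℝ} (hcadlag : ∀ ω, IsCadlag fun t => M t ω)
    (hmeas : ∀ t, Measurable (M t)) (hbdd : ∀ T, ∃ C : ℝ, ∀ t ≤ T, ∀ ω, |M t ω| ≤ C)
    (G : Set (PathOmega E)) {t : ℝ≥0} {k : ℕ → ℝ≥0} (hk : ∀ n, t ≤ k n)
    (hlim : Tendsto k atTop (𝓝 t)) :
    Tendsto (fun n => ∫ ω in G, M (k n) ω ∂μ) atTop (𝓝 (∫ ω in G, M t ω ∂μ)) := by
  obtain ⟨T, hT⟩ := hlim.bddAbove_range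
  obtain ⟨C, hC⟩ := hbdd T
  refine tendsto_integral_of_dominated_convergence (fun _ => C)
    (fun n => (hmeas _).aestronglyMeasurable) (integrable_const C) (fun n => ?_) ?_
  · exact Eventually.of_forall fun ω => hC _ (hT (mem_range_self n)) ω
  · exact Eventually.of_forall fun ω => (hcadlag ω).tendsto_seq hk hlim

/-- The martingale property of a cadlag, locally bounded process may be tested on countably many
times and events. -/
theorem isMartingaleOn_iff_countable [BorelSpace E] {μ : Measure (PathOmega E)} [IsFiniteMeasure μ]
    {M : ℝ≥0 → PathOmega E → ℝ} (hcadlag : ∀ ω, IsCadlag fun t => M t ω)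
    (hmeas : ∀ t, Measurable (M t)) (hbdd : ∀ T, ∃ C : ℝ, ∀ t ≤ T, ∀ ω, |M t ω| ≤ C) (s : ℝ≥0)
    {C : Set (Set (DenseTime → E))} (hC : MeasurableSpace.pi = MeasurableSpace.generateFrom C)
    (hpi : IsPiSystem C) (huniv : univ ∈ C) :
    IsMartingaleOn E μ (Fot E) M s ↔ ∀ p q : DenseTime, s ≤ p → p ≤ q → ∀ B ∈ C,
      ∫ ω in stoppedSample p ⁻¹' B, M q ω ∂μ = ∫ ω in stoppedSample p ⁻¹' B, M p ω ∂μ := by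
  have hint : ∀ t, Integrable (M t) μ := fun t => by
    obtain ⟨K, hK⟩ := hbdd t
    exact Integrable.of_bound (hmeas t).aestronglyMeasurable K
      (Eventually.of_forall fun ω => hK t le_rfl ω)
  constructor
  · rintro ⟨-, h⟩ p q hp hpq B hB
    refine h p q hp hpq _ ?_
    rw [Fot_eq_comap]
    exact ⟨B, hC ▸ MeasurableSpace.measurableSet_generateFrom hB, rfl⟩
  · intro h
    refine ⟨fun t _ => hint t, fun t u hst htu G hG => ?_⟩
    rcases htu.eq_or_lt with rfl | htu
    · rfl
    obtain ⟨k, hk, hklim⟩ := exists_seq_denseTime_tendsto t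
    obtain ⟨l, hl, hllim⟩ := exists_seq_denseTime_tendsto u
    refine tendsto_nhds_unique_of_eventuallyEq
      (tendsto_setIntegral_of_isCadlag hcadlag hmeas hbdd G (fun n => (hl n).le) hllim)
      (tendsto_setIntegral_of_isCadlag hcadlag hmeas hbdd G (fun n => (hk n).le) hklim) ?_
    filter_upwards [hklim.eventually_lt_const htu] with n hn
    have hGk := Fot_mono (hk n).le G hG
    rw [Fot_eq_comap] at hGk
    obtain ⟨B, hB, rfl⟩ := hGk
    exact setIntegral_eq_of_isPiSystem (hint _) (hint _) (measurable_stoppedSample _) hC hpi huniv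
      (h (k n) (l n) (hst.trans (hk n).le) (hn.trans (hl n)).le) hB

theorem measurableSet_isMartingaleOn [BorelSpace E] [SecondCountableTopology E]
    {M : ℝ≥0 → PathOmega E → ℝ} (hcadlag : ∀ ω, IsCadlag fun t => M t ω)
    (hmeas : ∀ t, Measurable (M t)) (hbdd : ∀ T, ∃ C : ℝ, ∀ t ≤ T, ∀ ω, |M t ω| ≤ C) (s : ℝ≥0) :
    MeasurableSet {μ : ProbabilityMeasure (PathOmega E) |
      IsMartingaleOn E (μ : Measure (PathOmega E)) (Fot E) M s} := by
  obtain ⟨C, hCc, hpi, huniv, hC⟩ := exists_countable_isPiSystem_generateFrom (DenseTime → E)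
  have hCm : ∀ B ∈ C, MeasurableSet B := fun B hB =>
    hC ▸ MeasurableSpace.measurableSet_generateFrom hB
  simp_rw [isMartingaleOn_iff_countable hcadlag hmeas hbdd s hC hpi huniv, ofPred_forall]
  refine MeasurableSet.iInter fun p => MeasurableSet.iInter fun q => MeasurableSet.iInter fun _ =>
    MeasurableSet.iInter fun _ => MeasurableSet.biInter hCc fun B hB => ?_
  have hB' := measurable_stoppedSample p.1 (hCm B hB)
  exact measurableSet_eq_fun (measurable_setIntegral_probabilityMeasure (hmeas _) hB')
    (measurable_setIntegral_probabilityMeasure (hmeas _) hB')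

/-- The solution map of a well-posed martingale problem is measurable at every initial time: its
graph is Borel, so that its projection on the initial condition is a measurable embedding. -/
theorem measurable_Fot_solution [TopologicalSpace.SeparableSpace E] [CompleteSpace E]
    [BorelSpace E] {χ : Set (ℝ≥0 → PathOmega E → ℝ)} (hχcount : χ.Countable)
    (hχcadlag : ∀ M ∈ χ, ∀ ω : PathOmega E, IsCadlag fun t => M t ω)
    (hχmeas : ∀ M ∈ χ, ∀ t : ℝ≥0, Measurable (M t))
    (hχbdd : ∀ M ∈ χ, ∀ T : ℝ≥0, ∃ C : ℝ, ∀ t ≤ T, ∀ ω : PathOmega E, |M t ω| ≤ C) {s : ℝ≥0}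
    {P : PathOmega E → ProbabilityMeasure (PathOmega E)}
    (hsol : ∀ η, SolvesMP E χ s η (P η : Measure (PathOmega E)))
    (huniq : ∀ η (μ : ProbabilityMeasure (PathOmega E)),
      SolvesMP E χ s η (μ : Measure (PathOmega E)) → μ = P η) :
    Measurable[Fot E s] P := by
  have : SecondCountableTopology E := UniformSpace.secondCountable_of_separable E
  rcases isEmpty_or_nonempty (PathOmega E) with _ | ⟨⟨η₀⟩⟩
  · exact @measurable_of_empty _ _ (Fot E s) _ _ _
  let Γ : Set ((DenseTime → E) × ProbabilityMeasure (PathOmega E)) :=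
    {p | (p.2 : Measure (PathOmega E)) {ω | stoppedSample s ω = p.1} = 1} ∩
      Prod.snd ⁻¹' ⋂ M ∈ χ, {μ : ProbabilityMeasure (PathOmega E) |
        IsMartingaleOn E (μ : Measure (PathOmega E)) (Fot E) M s}
  have hΓ : MeasurableSet Γ :=
    (measurableSet_setOf_apply_fiber_eq_one (measurable_stoppedSample s)).inter <| measurable_snd <|
      MeasurableSet.biInter hχcount fun M hM =>
        measurableSet_isMartingaleOn (hχcadlag M hM) (hχmeas M hM) (hχbdd M hM) s
  have mem_Γ : ∀ (η : PathOmega E) (μ : ProbabilityMeasure (PathOmega E)),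
      (stoppedSample s η, μ) ∈ Γ ↔ SolvesMP E χ s η (μ : Measure (PathOmega E)) := fun η μ => by
    simp [Γ, SolvesMP, stoppedSample_eq_iff]
  have exists_start : ∀ p ∈ Γ, ∃ η : PathOmega E, stoppedSample s η = p.1 := fun p hp => by
    by_contra! hne
    have h1 : (p.2 : Measure (PathOmega E)) {ω | stoppedSample s ω = p.1} = 1 := hp.1
    simp [hne] at h1
  have : StandardBorelSpace Γ := hΓ.standardBorel
  have hinj : Function.Injective fun p : Γ => p.1.1 := by
    rintro ⟨⟨y, μ⟩, hp⟩ ⟨⟨y', ν⟩, hq⟩ (rfl : y = y')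
    obtain ⟨η, rfl⟩ := exists_start _ hp
    rw [Subtype.mk.injEq, Prod.mk.injEq]
    exact ⟨rfl, (huniq η μ ((mem_Γ η μ).1 hp)).trans (huniq η ν ((mem_Γ η ν).1 hq)).symm⟩
  have hemb := (measurable_fst.comp (measurable_subtype_coe (p := (· ∈ Γ)))).measurableEmbedding hinj
  have hext := hemb.measurable_extend (g' := fun _ => P η₀)
    (measurable_snd.comp (measurable_subtype_coe (p := (· ∈ Γ)))) measurable_const
  have hP : P = Function.extend (fun p : Γ => p.1.1) (fun p : Γ => p.1.2) (fun _ => P η₀) ∘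
      stoppedSample s := by
    funext η
    exact (hinj.extend_apply (fun p : Γ => p.1.2) _
      ⟨(stoppedSample s η, P η), (mem_Γ η _).2 (hsol η)⟩).symm
  rw [hP, Fot_eq_comap]
  exact hext.comp (comap_measurable _)

end MartingaleProblem

/-- Proposition 4.10: if the martingale problem associated to
`χ` is well-posed with solutions `(ℙ^{s,η})`, then for every `s` the map
`η ↦ ℙ^{s,η}` is measurable from `Ω^s` (with the trace of `𝓕^o_s`) to the space
of measures (with the σ-field generated by the evaluation maps), and
`η ↦ ℙ^{s,η}` is `𝓕^o_s`-measurable on `Ω`, i.e. `(s,η) ↦ ℙ^{s,η}` is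
`𝓕^o`-adapted. -/
theorem measurable_MP_solutions [TopologicalSpace.SeparableSpace E]
    [CompleteSpace E] [BorelSpace E]
    (χ : Set (ℝ≥0 → PathOmega E → ℝ)) (hχcount : χ.Countable)
    (hχcadlag : ∀ M ∈ χ, ∀ ω : PathOmega E, IsCadlag fun t => M t ω)
    (hχadapted : ∀ M ∈ χ, ∀ t : ℝ≥0, Measurable[Fot E t] (M t))
    (hχbdd : ∀ T : ℝ≥0, ∃ C : ℝ, ∀ M ∈ χ, ∀ t ≤ T, ∀ ω : PathOmega E, |M t ω| ≤ C)
    (P : ℝ≥0 → PathOmega E → Measure (PathOmega E))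
    (hprob : ∀ (s : ℝ≥0) (η : PathOmega E), IsProbabilityMeasure (P s η))
    (hsol : ∀ (s : ℝ≥0) (η : PathOmega E), SolvesMP E χ s η (P s η))
    (huniq : ∀ (s : ℝ≥0) (η : PathOmega E) (μ : Measure (PathOmega E)),
      IsProbabilityMeasure μ → SolvesMP E χ s η μ → μ = P s η) :
    (∀ s : ℝ≥0,
      Measurable[MeasurableSpace.comap Subtype.val (Fot E s)]
        fun η : {η : PathOmega E // ∀ r : ℝ≥0, s ≤ r → η.1 r = η.1 s} =>
          P s η.1) ∧
    ∀ s : ℝ≥0, Measurable[Fot E s] fun η : PathOmega E => P s η := by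
  have hP : ∀ s : ℝ≥0, Measurable[Fot E s] fun η : PathOmega E => P s η := fun s =>
    measurable_subtype_coe.comp <|
      measurable_Fot_solution (P := fun η => ⟨P s η, hprob s η⟩) hχcount hχcadlag
        (fun M hM t => (hχadapted M hM t).mono (Fot_le t) le_rfl)
        (fun M hM T => (hχbdd T).imp fun _ hC => hC M hM) (hsol s)
        fun η μ hμ => Subtype.ext (huniq s η μ μ.2 hμ)
  exact ⟨fun s => (hP s).comp (comap_measurable Subtype.val), hP⟩
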